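/- For integers n ≥ 2 and real t > 0, the Wronskians W_{1,n} satisfy the recursion W_{1,n+1}(t) = (Π_{r=0}^{n-1} r!) · (log t)^n / t^{n(n-1)/2} + n! · t^{-(n-1)} · W_{1,n}(t). -/

import Mathlib

open Real Finset

/-- `xfun m t = t * (log t)^(m-1)`. -/
noncomputable def xfun (m : ℕ) : ℝ → ℝ := fun t => t * (Real.log t) ^ (m - 1)

/-- `Wkn n k t` is the Wronskian of the `n-1` functions
`x_1', …, x_{k-1}', x_{k+1}', …, x_n'` at `t`: the determinant of the
`(n-1)×(n-1)` matrix whose `(i,m)` entry is the `(i-1)`-st derivative of the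
`m`-th function of this list. -/
noncomputable def Wkn (n k : ℕ) (t : ℝ) : ℝ :=
  (Matrix.of fun i m : Fin (n - 1) =>
    iteratedDeriv (i : ℕ)
      (deriv (xfun (if (m : ℕ) + 1 < k then (m : ℕ) + 1 else (m : ℕ) + 2))) t).det

open Polynomial in
theorem iteratedDeriv_eval_log (q : ℝ[X]) (i : ℕ) {t : ℝ} (ht : 0 < t) :
    iteratedDeriv i (fun u : ℝ => q.eval (Real.log u)) t =
      (t ^ i)⁻¹ * ((aeval (derivative (R := ℝ)) (descPochhammer ℝ i)) q).eval (Real.log t) := by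
  induction i generalizing t with
  | zero => simp
  | succ i ih =>
    rw [iteratedDeriv_succ]
    have hev : iteratedDeriv i (fun u : ℝ => q.eval (Real.log u)) =ᶠ[nhds t] fun u =>
        (u ^ i)⁻¹ *
          ((aeval (derivative (R := ℝ)) (descPochhammer ℝ i)) q).eval (Real.log u) := by
      filter_upwards [eventually_gt_nhds ht] with u hu using ih hu
    rw [hev.deriv_eq]
    have hcomm : (aeval (derivative (R := ℝ)) (descPochhammer ℝ (i + 1))) q =
        derivative ((aeval (derivative (R := ℝ)) (descPochhammer ℝ i)) q) -
          C (i : ℝ) * (aeval (derivative (R := ℝ)) (descPochhammer ℝ i)) q := by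
      rw [descPochhammer_succ_right, mul_comm, map_mul, Module.End.mul_apply, map_sub, aeval_X,
        map_natCast, LinearMap.sub_apply, Module.End.natCast_apply, nsmul_eq_mul]
      simp
    rw [hcomm]
    set r := (aeval (derivative (R := ℝ)) (descPochhammer ℝ i)) q
    have h1 : HasDerivAt (fun u : ℝ => (u ^ i)⁻¹) (-(i * t ^ (i - 1)) / (t ^ i) ^ 2) t :=
      (hasDerivAt_pow i t).inv (pow_ne_zero _ ht.ne')
    have h2 : HasDerivAt (fun u : ℝ => r.eval (Real.log u))
        ((derivative r).eval (Real.log t) * t⁻¹) t :=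
      (r.hasDerivAt (Real.log t)).comp t (Real.hasDerivAt_log ht.ne')
    rw [(h1.fun_mul h2).deriv]
    rcases i with _ | i
    · simp; ring
    · simp only [eval_sub, eval_mul, eval_C, Nat.add_sub_cancel]
      field_simp
      ring

open Polynomial in
/-- Wronskians of polynomials in `log` at `t` in terms of the Wronskians of the polynomials. -/
theorem det_iteratedDeriv_eval_log {N : ℕ} (q : Fin N → ℝ[X]) {t : ℝ} (ht : 0 < t) :
    (Matrix.of fun i j : Fin N =>
        iteratedDeriv (i : ℕ) (fun u : ℝ => (q j).eval (Real.log u)) t).det =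
      (∏ i : Fin N, (t ^ (i : ℕ))⁻¹) *
        (Matrix.of fun i j : Fin N => (derivative^[(i : ℕ)] (q j)).eval (Real.log t)).det := by
  let c : Matrix (Fin N) (Fin N) ℝ := Matrix.of fun i k => (descPochhammer ℝ i).coeff k
  let B : Matrix (Fin N) (Fin N) ℝ :=
    Matrix.of fun i j => (derivative^[(i : ℕ)] (q j)).eval (Real.log t)
  have hc : c.det = 1 := by
    rw [Matrix.det_of_isLowerTriangular c]
    · refine Finset.prod_eq_one fun i _ => ?_
      have h := monic_descPochhammer ℝ (i : ℕ)
      rw [Monic, leadingCoeff, descPochhammer_natDegree] at h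
      exact h
    · intro i j hij
      apply coeff_eq_zero_of_natDegree_lt
      rw [descPochhammer_natDegree]
      exact hij
  have hmul : (Matrix.of fun i j : Fin N =>
        iteratedDeriv (i : ℕ) (fun u : ℝ => (q j).eval (Real.log u)) t) =
      Matrix.of fun i j : Fin N => (t ^ (i : ℕ))⁻¹ * (c * B) i j := by
    ext i j
    rw [Matrix.of_apply, Matrix.of_apply, iteratedDeriv_eval_log _ _ ht, Matrix.mul_apply,
      aeval_eq_sum_range' (n := N)
        (by rw [descPochhammer_natDegree]; exact i.2),
      ← Fin.sum_univ_eq_sum_range (fun k => (descPochhammer ℝ (i : ℕ)).coeff k •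
        (derivative (R := ℝ)) ^ k)]
    simp [c, B, LinearMap.sum_apply, eval_finsetSum, Module.End.pow_apply]
  rw [hmul, Matrix.det_mul_column, Matrix.det_mul, hc, one_mul]

/-- The `i`-th derivative of `s ^ m / m!`. -/
noncomputable def dividedPow (s : ℝ) (m i : ℕ) : ℝ :=
  m.descFactorial i * s ^ (m - i) / m.factorial

/-- The partial sum of order `m` of the exponential series at `s`. -/
noncomputable def expPartialSum (s : ℝ) (m : ℕ) : ℝ :=
  ∑ k ∈ Finset.range (m + 1), s ^ k / k.factorial

theorem dividedPow_of_lt (s : ℝ) {m i : ℕ} (h : m < i) : dividedPow s m i = 0 := by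
  simp [dividedPow, Nat.descFactorial_of_lt h]

theorem dividedPow_self (s : ℝ) (m : ℕ) : dividedPow s m m = 1 := by
  simp [dividedPow, Nat.descFactorial_self, Nat.factorial_ne_zero]

theorem dividedPow_succ_succ (s : ℝ) (m i : ℕ) :
    dividedPow s (m + 1) (i + 1) = dividedPow s m i := by
  have h : (m.factorial : ℝ) ≠ 0 := by positivity
  have h' : (m : ℝ) + 1 ≠ 0 := by positivity
  simp only [dividedPow, Nat.succ_descFactorial_succ, Nat.factorial_succ, Nat.add_sub_add_right]
  push_cast
  field_simp

theorem sum_alternating_dividedPow (s : ℝ) (m : ℕ) :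
    ∑ i ∈ Finset.range (m + 2), (-1) ^ i * (s ^ i / i.factorial) * dividedPow s (m + 1) i = 0 := by
  have h := add_pow (-s) s (m + 1)
  rw [neg_add_cancel, zero_pow (Nat.succ_ne_zero m)] at h
  calc _ = ∑ i ∈ Finset.range (m + 1 + 1),
        (-s) ^ i * s ^ (m + 1 - i) * ((m + 1).choose i) * ((m + 1).factorial : ℝ)⁻¹ := by
        refine Finset.sum_congr rfl fun i _ => ?_
        have h1 : (i.factorial : ℝ) ≠ 0 := by positivity
        rw [dividedPow, Nat.descFactorial_eq_factorial_mul_choose, neg_pow s]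
        push_cast
        field_simp
    _ = 0 := by rw [← Finset.sum_mul, ← h, zero_mul]

theorem sum_expPartialSum_mul_dividedPow (s : ℝ) (m : ℕ) :
    ∑ i ∈ Finset.range (m + 2),
      (-1) ^ i * expPartialSum s i * (dividedPow s (m + 1) i + dividedPow s m i) = 0 := by
  rw [← sum_alternating_dividedPow s m]
  simp only [mul_add, Finset.sum_add_distrib]
  rw [Finset.sum_range_succ' _ (m + 1), Finset.sum_range_succ _ (m + 1),
    Finset.sum_range_succ' _ (m + 1), dividedPow_of_lt s (Nat.lt_succ_self m), mul_zero, add_zero,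
    add_right_comm, ← Finset.sum_add_distrib]
  congr 1
  · refine Finset.sum_congr rfl fun i _ => ?_
    rw [dividedPow_succ_succ, expPartialSum, Finset.sum_range_succ, ← expPartialSum]
    ring
  · simp [expPartialSum]

theorem det_dividedPow (s : ℝ) (N : ℕ) :
    (Matrix.of fun i j : Fin N => dividedPow s (j + 1) i + dividedPow s j i).det =
      expPartialSum s N := by
  rcases N with _ | N
  · simp [expPartialSum]
  set A : Matrix (Fin (N + 1)) (Fin (N + 1)) ℝ :=
    Matrix.of fun i j => dividedPow s (j + 1) i + dividedPow s j i with hA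
  let c : Fin (N + 1) → ℝ := fun i => (-1) ^ (i : ℕ) * expPartialSum s i
  have hrow (j : Fin (N + 1)) : (∑ k, c k • A k) j =
      ∑ i ∈ Finset.range (N + 1), (-1) ^ i * expPartialSum s i *
        (dividedPow s (j + 1) i + dividedPow s j i) := by
    rw [← Fin.sum_univ_eq_sum_range (fun i => (-1) ^ i * expPartialSum s i *
        (dividedPow s (j + 1) i + dividedPow s j i))]
    simp [c, hA]
  have hcast (j : Fin N) : (∑ k, c k • A k) j.castSucc = 0 := by
    rw [hrow, ← sum_expPartialSum_mul_dividedPow s j]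
    symm
    apply Finset.sum_subset
    · intro i
      have := j.2
      simp only [Finset.mem_range]
      omega
    · intro i _ hi
      simp only [Finset.mem_range, not_lt] at hi
      rw [dividedPow_of_lt s (by omega), dividedPow_of_lt s (by omega)]
      simp
  have hlast : (∑ k, c k • A k) (Fin.last N) = (-1) ^ N * expPartialSum s (N + 1) := by
    have h := sum_expPartialSum_mul_dividedPow s N
    rw [Finset.sum_range_succ, dividedPow_self, dividedPow_of_lt s (Nat.lt_succ_self N)] at h
    rw [hrow, Fin.val_last]
    linear_combination h
  have hminor : (A.submatrix Fin.succ Fin.castSucc).det = 1 := by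
    rw [Matrix.det_of_isUpperTriangular]
    · refine Finset.prod_eq_one fun i _ => ?_
      simp [hA, dividedPow_self, dividedPow_of_lt]
    · intro i j hij
      have hij' : (j : ℕ) < i := hij
      simp only [hA, Matrix.submatrix_apply, Matrix.of_apply, Fin.val_succ, Fin.val_castSucc]
      rw [dividedPow_of_lt s (by omega), dividedPow_of_lt s (by omega), add_zero]
  have hdet := Matrix.det_updateRow_sum A 0 c
  have hc0 : c 0 = 1 := by simp [c, expPartialSum]
  rw [hc0, one_smul] at hdet
  rw [← hdet, Matrix.det_succ_row_zero, Fin.sum_univ_castSucc]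
  simp only [Matrix.updateRow_self, hcast, hlast, mul_zero, zero_mul, Finset.sum_const_zero,
    zero_add, Fin.succAbove_last, Fin.val_last]
  have hsub : (A.updateRow 0 (∑ k, c k • A k)).submatrix Fin.succ Fin.castSucc =
      A.submatrix Fin.succ Fin.castSucc := by
    ext i j
    simp
  rw [hsub, hminor, mul_one, ← mul_assoc, ← mul_pow]
  simp

open Polynomial in
theorem deriv_xfun_eq_eval_log (j : ℕ) {t : ℝ} (ht : 0 < t) :
    deriv (xfun (j + 2)) t = ((X ^ (j + 1) + C ((j : ℝ) + 1) * X ^ j : ℝ[X])).eval (Real.log t) := by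
  have h := (hasDerivAt_id t).fun_mul ((Real.hasDerivAt_log ht.ne').fun_pow (j + 1))
  have hx : xfun (j + 2) = fun u => id u * Real.log u ^ (j + 1) := by
    ext u
    simp [xfun]
  rw [hx, h.deriv]
  simp only [id, eval_add, eval_mul, eval_pow, eval_X, eval_C, Nat.add_sub_cancel]
  push_cast
  field_simp

open Polynomial in
theorem Wkn_one_eq (N : ℕ) {t : ℝ} (ht : 0 < t) :
    Wkn (N + 1) 1 t = (∏ i ∈ Finset.range N, (t ^ i)⁻¹) *
      ((∏ j ∈ Finset.range N, ((j + 1).factorial : ℝ)) * expPartialSum (Real.log t) N) := by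
  have hW : Wkn (N + 1) 1 t = (Matrix.of fun i j : Fin N =>
      iteratedDeriv (i : ℕ) (fun u : ℝ =>
        ((X ^ ((j : ℕ) + 1) + C ((j : ℝ) + 1) * X ^ (j : ℕ) : ℝ[X])).eval (Real.log u)) t).det := by
    simp only [Wkn]
    congr 1
    ext i j
    simp only [Matrix.of_apply]
    rw [if_neg (by omega)]
    apply Filter.EventuallyEq.iteratedDeriv_eq
    filter_upwards [eventually_gt_nhds ht] with u hu using deriv_xfun_eq_eval_log j hu
  rw [hW, det_iteratedDeriv_eval_log _ ht, ← det_dividedPow,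
    Fin.prod_univ_eq_prod_range (fun i => (t ^ i)⁻¹),
    ← Fin.prod_univ_eq_prod_range (fun j => ((j + 1).factorial : ℝ)), ← Matrix.det_mul_row]
  congr 2
  ext i j
  have h1 : ((j : ℕ).factorial : ℝ) ≠ 0 := by positivity
  have h2 : ((j : ℕ) : ℝ) + 1 ≠ 0 := by positivity
  simp only [Matrix.of_apply, iterate_map_add, iterate_derivative_C_mul,
    iterate_derivative_X_pow_eq_smul, dividedPow, Nat.factorial_succ, eval_add, eval_mul, eval_C,
    eval_smul, eval_pow, eval_X, smul_eq_mul]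
  push_cast
  field_simp

theorem stmt_13 (n : ℕ) (hn : 2 ≤ n) (t : ℝ) (ht : 0 < t) :
    Wkn (n + 1) 1 t =
      (∏ r ∈ Finset.range n, (Nat.factorial r : ℝ)) * (Real.log t) ^ n / t ^ (n * (n - 1) / 2) +
        (Nat.factorial n : ℝ) * (1 / t ^ (n - 1)) * Wkn n 1 t := by
  obtain ⟨N, rfl⟩ : ∃ N, n = N + 1 := ⟨n - 1, by omega⟩
  have hpow : t ^ ((N + 1) * (N + 1 - 1) / 2) = ∏ i ∈ Finset.range (N + 1), t ^ i := by
    rw [Finset.prod_pow_eq_pow_sum, Finset.sum_range_id]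
  have hfac : ∏ r ∈ Finset.range (N + 1), (r.factorial : ℝ) =
      ∏ j ∈ Finset.range N, ((j + 1).factorial : ℝ) := by
    rw [Finset.prod_range_succ']
    simp
  have hE : expPartialSum (Real.log t) (N + 1) =
      expPartialSum (Real.log t) N + Real.log t ^ (N + 1) / (N + 1).factorial :=
    Finset.sum_range_succ _ _
  have hf : ((N + 1).factorial : ℝ) ≠ 0 := by positivity
  rw [Wkn_one_eq _ ht, Wkn_one_eq _ ht, hpow, hfac, hE, div_eq_mul_inv _ (∏ i ∈ _, _),
    ← Finset.prod_inv_distrib, Finset.prod_range_succ _ N, Finset.prod_range_succ _ N,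
    Nat.add_sub_cancel]
  field_simp
  ring
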